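/- arXiv:1704.08334 — 2 statements merged into one kernel-verified Lean document; each statement's English description precedes it below -/
import Mathlib

section
/- As a → ∞, g₂(a) ~ 4 π^{-1/2} a^{-2} exp(−a²/4); that is, the ratio g₂(a) / (4 π^{-1/2} a^{-2} exp(−a²/4)) tends to 1 as a → ∞. -/
open MeasureTheory Real Filter

/-- The heat kernel on ℝ: `p r w = (2πr)^{-1/2} exp(-w²/(2r))`. -/
noncomputable def heatKernel (r w : ℝ) : ℝ :=
  (2 * Real.pi * r) ^ (-(1 : ℝ) / 2) * Real.exp (-w ^ 2 / (2 * r))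

/-- The incomplete Green's function of the heat kernel:
`g_t(a) = ∫₀^t p_r(a) dr`. -/
noncomputable def greenIncomplete (t a : ℝ) : ℝ :=
  ∫ r in (0 : ℝ)..t, heatKernel r a

lemma heatKernel_nonneg {r : ℝ} (hr : 0 ≤ r) (a : ℝ) : 0 ≤ heatKernel r a := by
  unfold heatKernel
  positivity

lemma heatKernel_pos {r : ℝ} (hr : 0 < r) (a : ℝ) : 0 < heatKernel r a := by
  unfold heatKernel
  positivity

lemma heatKernel_le {r : ℝ} (hr : 0 ≤ r) (a : ℝ) :
    heatKernel r a ≤ (2 * Real.pi * r) ^ (-(1 : ℝ) / 2) := by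
  have hexp : Real.exp (-a ^ 2 / (2 * r)) ≤ 1 := by
    rw [Real.exp_le_one_iff, neg_div]
    exact neg_nonpos.2 (by positivity)
  exact mul_le_of_le_one_right (by positivity) hexp

lemma measurable_heatKernel (a : ℝ) : Measurable fun r => heatKernel r a := by
  unfold heatKernel
  fun_prop

lemma intervalIntegrable_heatKernel {t : ℝ} (ht : 0 ≤ t) (a : ℝ) :
    IntervalIntegrable (fun r => heatKernel r a) volume 0 t := by
  have hpow : IntervalIntegrable
      (fun r : ℝ => (2 * Real.pi) ^ (-(1 : ℝ) / 2) * r ^ (-(1 : ℝ) / 2)) volume 0 t :=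
    (intervalIntegral.intervalIntegrable_rpow' (by norm_num)).const_mul _
  refine hpow.mono_fun' (measurable_heatKernel a).aestronglyMeasurable ?_
  refine (ae_restrict_iff' measurableSet_uIoc).2 (ae_of_all _ fun r hr => ?_)
  rw [Set.uIoc_of_le ht] at hr
  beta_reduce
  rw [Real.norm_of_nonneg (heatKernel_nonneg hr.1.le a),
    ← Real.mul_rpow (by positivity) hr.1.le]
  exact heatKernel_le hr.1.le a

lemma hasDerivAt_heatKernel {r : ℝ} (hr : 0 < r) (a : ℝ) :
    HasDerivAt (fun s => heatKernel s a)
      (heatKernel r a * (a ^ 2 / (2 * r ^ 2) - 1 / (2 * r))) r := by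
  have hlin : HasDerivAt (fun s : ℝ => 2 * Real.pi * s) (2 * Real.pi) r := by
    simpa using (hasDerivAt_id r).const_mul (2 * Real.pi)
  have hden : HasDerivAt (fun s : ℝ => 2 * s) 2 r := by
    simpa using (hasDerivAt_id r).const_mul (2 : ℝ)
  have hpos : 0 < 2 * Real.pi * r := by positivity
  have hpow := hlin.rpow_const (p := -(1 : ℝ) / 2) (Or.inl hpos.ne')
  have hexp := ((hasDerivAt_const r (-a ^ 2)).div hden (by positivity)).exp
  refine (hpow.mul hexp).congr_deriv ?_
  rw [Real.rpow_sub_one hpos.ne']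
  simp only [heatKernel, Pi.div_apply]
  field_simp
  ring

lemma continuousOn_sq_mul_heatKernel (a : ℝ) :
    ContinuousOn (fun r => r ^ 2 * heatKernel r a) (Set.Ici 0) := by
  intro r hr
  rcases (Set.mem_Ici.1 hr).eq_or_lt with rfl | hr
  · have hbound : Tendsto (fun r : ℝ => r * (2 * Real.pi)⁻¹ * √(2 * Real.pi * r))
        (nhdsWithin 0 (Set.Ici 0)) (nhds 0) := by
      have hcont : Continuous fun r : ℝ => r * (2 * Real.pi)⁻¹ * √(2 * Real.pi * r) := by
        fun_prop
      simpa using (hcont.tendsto 0).mono_left nhdsWithin_le_nhds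
    rw [ContinuousWithinAt, zero_pow two_ne_zero, zero_mul]
    refine squeeze_zero' ?_ ?_ hbound <;> filter_upwards [self_mem_nhdsWithin] with s hs
    · exact mul_nonneg (sq_nonneg s) (heatKernel_nonneg hs a)
    · rcases (Set.mem_Ici.1 hs).eq_or_lt with rfl | hs
      · simp
      · have hpos : 0 < 2 * Real.pi * s := by positivity
        have hsqrt : √(2 * Real.pi * s) =
            (2 * Real.pi * s) ^ (-(1 : ℝ) / 2) * (2 * Real.pi * s) := by
          rw [← Real.rpow_add_one hpos.ne', Real.sqrt_eq_rpow]
          norm_num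
        calc s ^ 2 * heatKernel s a
            ≤ s ^ 2 * (2 * Real.pi * s) ^ (-(1 : ℝ) / 2) :=
              mul_le_mul_of_nonneg_left (heatKernel_le hs.le a) (sq_nonneg s)
          _ = s * (2 * Real.pi)⁻¹ * √(2 * Real.pi * s) := by
              rw [hsqrt]
              field_simp
  · exact ((continuousAt_id.pow 2).mul
      (hasDerivAt_heatKernel hr a).continuousAt).continuousWithinAt

/-- Integration by parts for the incomplete Green's function. -/
lemma greenIncomplete_add_integral {t a : ℝ} (ht : 0 ≤ t) (ha : a ≠ 0) :
    greenIncomplete t a + 3 / a ^ 2 * ∫ r in (0 : ℝ)..t, r * heatKernel r a =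
      2 * t ^ 2 / a ^ 2 * heatKernel t a := by
  have hint := intervalIntegrable_heatKernel ht a
  have hint' : IntervalIntegrable (fun r => 3 / a ^ 2 * (r * heatKernel r a)) volume 0 t :=
    (hint.continuousOn_mul continuousOn_id).const_mul _
  have hftc := intervalIntegral.integral_eq_sub_of_hasDerivAt_of_le ht
    (f := fun r => 2 / a ^ 2 * (r ^ 2 * heatKernel r a))
    (f' := fun r => heatKernel r a + 3 / a ^ 2 * (r * heatKernel r a))
    (((continuousOn_sq_mul_heatKernel a).mono Set.Icc_subset_Ici_self).const_mul _)
    (fun r hr => by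
      have hr0 : r ≠ 0 := hr.1.ne'
      refine (((hasDerivAt_pow 2 r).mul (hasDerivAt_heatKernel hr.1 a)).const_mul
        (2 / a ^ 2)).congr_deriv ?_
      field_simp
      ring)
    (hint.add hint')
  rw [intervalIntegral.integral_add hint hint', intervalIntegral.integral_const_mul] at hftc
  rw [greenIncomplete, hftc]
  ring

lemma greenIncomplete_le {t a : ℝ} (ht : 0 ≤ t) (ha : a ≠ 0) :
    greenIncomplete t a ≤ 2 * t ^ 2 / a ^ 2 * heatKernel t a := by
  rw [← greenIncomplete_add_integral ht ha]
  have : 0 ≤ ∫ r in (0 : ℝ)..t, r * heatKernel r a :=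
    intervalIntegral.integral_nonneg ht fun r hr => mul_nonneg hr.1 (heatKernel_nonneg hr.1 a)
  exact le_add_of_nonneg_right (by positivity)

lemma le_greenIncomplete_mul {t a : ℝ} (ht : 0 ≤ t) (ha : a ≠ 0) :
    2 * t ^ 2 / a ^ 2 * heatKernel t a ≤ greenIncomplete t a * (1 + 3 * t / a ^ 2) := by
  have hint := intervalIntegrable_heatKernel ht a
  have hle : ∫ r in (0 : ℝ)..t, r * heatKernel r a ≤ t * greenIncomplete t a := by
    rw [greenIncomplete, ← intervalIntegral.integral_const_mul]
    exact intervalIntegral.integral_mono_on ht (hint.continuousOn_mul continuousOn_id)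
      (hint.const_mul t) fun r hr =>
        mul_le_mul_of_nonneg_right hr.2 (heatKernel_nonneg hr.1 a)
  calc 2 * t ^ 2 / a ^ 2 * heatKernel t a
      = greenIncomplete t a + 3 / a ^ 2 * ∫ r in (0 : ℝ)..t, r * heatKernel r a :=
        (greenIncomplete_add_integral ht ha).symm
    _ ≤ greenIncomplete t a + 3 / a ^ 2 * (t * greenIncomplete t a) := by gcongr
    _ = greenIncomplete t a * (1 + 3 * t / a ^ 2) := by ring

/-- For fixed `t > 0`, `g_t(a) ∼ 2 t² a⁻² p_t(a)` as `a → ∞`. -/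
lemma tendsto_greenIncomplete_div {t : ℝ} (ht : 0 < t) :
    Tendsto (fun a => greenIncomplete t a / (2 * t ^ 2 / a ^ 2 * heatKernel t a))
      atTop (nhds 1) := by
  have hlower : Tendsto (fun a : ℝ => (1 + 3 * t / a ^ 2)⁻¹) atTop (nhds 1) := by
    have h := (tendsto_const_nhds (x := (1 : ℝ))).add
      ((tendsto_const_nhds (x := 3 * t)).div_atTop (tendsto_pow_atTop (α := ℝ) two_ne_zero))
    simpa using h.inv₀ (by norm_num)
  refine tendsto_of_tendsto_of_tendsto_of_le_of_le' hlower tendsto_const_nhds ?_ ?_ <;>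
    filter_upwards [eventually_gt_atTop 0] with a ha <;>
    have hpos : 0 < 2 * t ^ 2 / a ^ 2 * heatKernel t a :=
      mul_pos (by positivity) (heatKernel_pos ht a)
  · rw [le_div_iff₀ hpos, inv_mul_le_iff₀ (by positivity), mul_comm (1 + _)]
    exact le_greenIncomplete_mul ht.le ha.ne'
  · exact (div_le_one hpos).2 (greenIncomplete_le ht.le ha.ne')

/-- As `a → ∞`, `g₂(a) ∼ 4 π^{-1/2} a^{-2} exp(−a²/4)`. -/
theorem greenIncomplete_asymptotic :
    Tendsto
      (fun a : ℝ => greenIncomplete 2 a /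
        (4 * Real.pi ^ (-(1 : ℝ) / 2) * a ^ (-(2 : ℝ)) * Real.exp (-a ^ 2 / 4)))
      atTop (nhds 1) := by
  refine (tendsto_greenIncomplete_div two_pos).congr' ?_
  filter_upwards [eventually_gt_atTop 0] with a ha
  have hfour : (4 : ℝ) ^ (-(1 : ℝ) / 2) = 1 / 2 := by
    rw [show (4 : ℝ) = 2 ^ (2 : ℝ) by norm_num, ← Real.rpow_mul (by norm_num)]
    norm_num [Real.rpow_neg_one]
  have hsq : a ^ (-(2 : ℝ)) = (a ^ 2)⁻¹ := by
    rw [Real.rpow_neg ha.le, Real.rpow_two]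
  rw [heatKernel, hsq, show 2 * Real.pi * 2 = 4 * Real.pi by ring,
    Real.mul_rpow (by norm_num) Real.pi_pos.le, hfour, show (2 : ℝ) * 2 = 4 by norm_num]
  congr 1
  ring
end

section
/- For all ε, δ ∈ (0,1), ∫₀^ε ∫_{{y ∈ ℝ : |y| > √(2ε log(1/δ))}} (p_s(y))² dy ds < δ² √ε. (This is the L²-distance squared between the solution of the constant-coefficient stochastic heat equation at time ε and its truncation to the spatial window of half-width √(2ε log(1/δ)).) -/
open MeasureTheory Real

/-- The heat kernel squared is a rescaled Gaussian. -/
theorem heatKernel_sq {s : ℝ} (hs : 0 < s) (y : ℝ) :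
    heatKernel s y ^ 2 = (2 * Real.pi * s)⁻¹ * Real.exp (-(1 / s) * y ^ 2) := by
  have h : 0 < 2 * Real.pi * s := by positivity
  rw [heatKernel, mul_pow, ← Real.rpow_natCast, ← Real.rpow_mul h.le, ← Real.exp_nat_mul]
  congr 1
  · norm_num [Real.rpow_neg_one]
  · congr 1
    push_cast
    field_simp

/-- A two-sided integral of a function of `|y|` outside `[-a, a]`. -/
theorem setIntegral_comp_abs_lt {a : ℝ} (ha : 0 ≤ a) (f : ℝ → ℝ) :
    ∫ y in {y : ℝ | a < |y|}, f |y| = 2 * ∫ y in Set.Ioi a, f y := by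
  have hm : MeasurableSet {y : ℝ | a < |y|} := measurableSet_lt measurable_const continuous_abs.measurable
  have h := integral_comp_abs (f := (Set.Ioi a).indicator f)
  rw [setIntegral_indicator measurableSet_Ioi, Set.Ioi_inter_Ioi, sup_of_le_right ha] at h
  rw [← h, ← integral_indicator hm]
  rfl

/-- A sub-Gaussian bound for the tails of the Gaussian integral. -/
theorem setIntegral_gaussian_abs_lt_le {a b : ℝ} (ha : 0 ≤ a) (hb : 0 < b) :
    ∫ y in {y : ℝ | a < |y|}, Real.exp (-b * y ^ 2) ≤
      Real.exp (-b * a ^ 2) * √(Real.pi / b) := by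
  have h := setIntegral_comp_abs_lt ha fun y => Real.exp (-b * y ^ 2)
  simp only [sq_abs] at h
  have hshift : ∫ y in Set.Ioi a, Real.exp (-b * y ^ 2) =
      ∫ t in Set.Ioi (0 : ℝ), Real.exp (-b * (t + a) ^ 2) := by
    have := (measurePreserving_add_right volume a).setIntegral_preimage_emb
      (measurableEmbedding_addRight a) (fun y : ℝ => Real.exp (-b * y ^ 2)) (Set.Ioi a)
    simpa using this.symm
  have hle : ∫ t in Set.Ioi (0 : ℝ), Real.exp (-b * (t + a) ^ 2) ≤
      ∫ t in Set.Ioi (0 : ℝ), Real.exp (-b * a ^ 2) * Real.exp (-b * t ^ 2) := by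
    refine integral_mono_of_nonneg (.of_forall fun t => (Real.exp_pos _).le)
      ((integrable_exp_neg_mul_sq hb).integrableOn.const_mul _) ?_
    filter_upwards [ae_restrict_mem measurableSet_Ioi] with t ht
    rw [← Real.exp_add, Real.exp_le_exp]
    have := mul_nonneg hb.le (mul_nonneg (le_of_lt ht) ha)
    linarith
  rw [integral_const_mul, integral_gaussian_Ioi] at hle
  rw [h, hshift]
  linarith

/-- For all `ε, δ ∈ (0,1)`, the squared L²-distance between the solution of the
constant-coefficient stochastic heat equation at time `ε` and its spatial
truncation satisfies
`∫₀^ε ∫_{|y| > √(2ε log(1/δ))} (p_s(y))² dy ds < δ² √ε`. -/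
theorem truncation_error_bound (ε δ : ℝ) (hε : ε ∈ Set.Ioo (0 : ℝ) 1)
    (hδ : δ ∈ Set.Ioo (0 : ℝ) 1) :
    (∫ s in (0 : ℝ)..ε,
        ∫ y in {y : ℝ | Real.sqrt (2 * ε * Real.log (1 / δ)) < |y|},
          (heatKernel s y) ^ 2) < δ ^ 2 * Real.sqrt ε := by
  obtain ⟨hε0, -⟩ := hε
  obtain ⟨hδ0, hδ1⟩ := hδ
  have hL : 0 < Real.log (1 / δ) := Real.log_pos (by rw [lt_div_iff₀ hδ0]; linarith)
  set a := Real.sqrt (2 * ε * Real.log (1 / δ)) with ha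
  have ha2 : a ^ 2 = 2 * ε * Real.log (1 / δ) := Real.sq_sqrt (by positivity)
  have hinner : ∀ s ∈ Set.Ioc 0 ε, ∫ y in {y : ℝ | a < |y|}, heatKernel s y ^ 2 ≤
      δ ^ 2 / (2 * √Real.pi) * s ^ (-(1 / 2) : ℝ) := by
    rintro s ⟨hs, hsε⟩
    simp only [heatKernel_sq hs]
    rw [integral_const_mul]
    have hexp : Real.exp (-(1 / s) * a ^ 2) ≤ δ ^ 2 := by
      rw [← Real.exp_log (pow_pos hδ0 2), Real.exp_le_exp, ha2, Real.log_pow]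
      rw [one_div δ, Real.log_inv] at hL ⊢
      have : 1 ≤ ε / s := (one_le_div hs).2 hsε
      have h2 : -(1 / s) * (2 * ε * -Real.log δ) = 2 * (ε / s) * Real.log δ := by ring
      rw [h2]
      push_cast
      nlinarith
    have hsq : √(Real.pi / (1 / s)) = √Real.pi * √s := by
      rw [div_div_eq_mul_div, div_one, Real.sqrt_mul Real.pi_pos.le]
    calc _ ≤ (2 * Real.pi * s)⁻¹ * (δ ^ 2 * (√Real.pi * √s)) := by
          rw [← hsq]
          gcongr
          exact (setIntegral_gaussian_abs_lt_le (Real.sqrt_nonneg _) (by positivity)).trans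
            (by gcongr)
      _ = _ := by
          rw [Real.rpow_neg hs.le, ← Real.sqrt_eq_rpow]
          have h1 := Real.sq_sqrt hs.le
          have h2 := Real.sq_sqrt Real.pi_pos.le
          have h3 := Real.sqrt_pos.2 hs
          have h4 := Real.sqrt_pos.2 Real.pi_pos
          have : 2 * Real.pi * s = 2 * √Real.pi ^ 2 * √s ^ 2 := by rw [h1, h2]
          rw [this]
          field_simp
  have hint : IntervalIntegrable (fun s : ℝ => δ ^ 2 / (2 * √Real.pi) * s ^ (-(1 / 2) : ℝ))
      volume 0 ε := (intervalIntegral.intervalIntegrable_rpow' (by norm_num)).const_mul _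
  calc _ ≤ ∫ s in (0 : ℝ)..ε, δ ^ 2 / (2 * √Real.pi) * s ^ (-(1 / 2) : ℝ) := by
        rw [intervalIntegral.integral_of_le hε0.le, intervalIntegral.integral_of_le hε0.le]
        refine integral_mono_of_nonneg
          (.of_forall fun s => integral_nonneg fun y => sq_nonneg _) hint.1 ?_
        filter_upwards [ae_restrict_mem measurableSet_Ioc] with s hs using hinner s hs
    _ = δ ^ 2 * √ε / √Real.pi := by
        rw [intervalIntegral.integral_const_mul, integral_rpow (.inl (by norm_num)),
          Real.sqrt_eq_rpow ε]
        norm_num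
        field_simp
    _ < δ ^ 2 * √ε := by
        refine div_lt_self (by positivity) ?_
        rw [Real.lt_sqrt zero_le_one]
        linarith [Real.pi_gt_three]
end
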